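/- For every integer k ≥ 2, the string w_k = b · F*_{2k} over the alphabet {a, b} with a < b satisfies r(w_k) = 2k. -/

import Mathlib

/-! Basic definitions: strings as `List α`, rotations, runs, BWT, Lyndon
factorization, ω-order, bijective BWT, and Fibonacci words. -/

variable {α : Type*}

/-- Left cyclic rotation by one symbol. -/
def rot (x : List α) : List α := x.drop 1 ++ x.take 1

/-- The list of all `|x|` cyclic rotations of `x`. -/
def rotations (x : List α) : List (List α) :=
  (List.range x.length).map (fun i => rot^[i] x)

/-- ρ: the number of maximal runs of equal consecutive symbols. -/
def runsCount [DecidableEq α] : List α → ℕ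
  | [] => 0
  | [_] => 1
  | a :: b :: t => (if a = b then 0 else 1) + runsCount (b :: t)

/-- The Burrows–Wheeler transform: last symbols of the lexicographically
sorted rotations. -/
def BWT [LinearOrder α] (w : List α) : List α :=
  (List.insertionSort (· ≤ ·) (rotations w)).filterMap List.getLast?

/-- The lexicographically smallest rotation of `x`. -/
def lexMinRotation [LinearOrder α] (x : List α) : List α :=
  (List.insertionSort (· ≤ ·) (rotations x)).headD x

/-- A Lyndon word: nonempty and strictly smaller than all its proper rotations. -/
def IsLyndon [LinearOrder α] (x : List α) : Prop :=
  x ≠ [] ∧ ∀ i < x.length, 0 < i → x < rot^[i] x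

instance [LinearOrder α] : DecidablePred (IsLyndon (α := α)) := fun _ =>
  inferInstanceAs (Decidable (_ ∧ _))

/-- The longest prefix of `w` that is a Lyndon word (the first Lyndon factor). -/
def firstLyndonFactor [LinearOrder α] (w : List α) : List α :=
  (((List.range (w.length + 1)).map (fun i => w.take i)).filter
    (fun x => decide (IsLyndon x))).getLastD []

def lyndonFactAux [LinearOrder α] : ℕ → List α → List (List α)
  | 0, _ => []
  | _, [] => []
  | fuel+1, w =>
      let p := firstLyndonFactor w
      if p.isEmpty then [] else p :: lyndonFactAux fuel (w.drop p.length)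

/-- The Lyndon factorization of `w`: repeatedly peel off the longest Lyndon
prefix (equivalently, the unique nonincreasing factorization into Lyndon words). -/
def lyndonFactorization [LinearOrder α] (w : List α) : List (List α) :=
  lyndonFactAux w.length w

/-- `listPow x n = x^n`. -/
def listPow (x : List α) : ℕ → List α
  | 0 => []
  | n+1 => x ++ listPow x n

/-- ω-order: `x ≤ω y` iff `x^∞ ≤ y^∞` lexicographically; comparing the
equal-length words `x^{|y|}` and `y^{|x|}` is equivalent. -/
def omegaLE [LinearOrder α] (x y : List α) : Prop :=
  listPow x y.length ≤ listPow y x.length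

instance [LinearOrder α] : DecidableRel (omegaLE (α := α)) := fun _ _ =>
  inferInstanceAs (Decidable (_ ≤ _))

/-- The bijective Burrows–Wheeler transform: last symbols of all rotations of
all Lyndon factors of `w`, sorted in ω-order. -/
def BBWT [LinearOrder α] (w : List α) : List α :=
  (List.insertionSort omegaLE
    (((lyndonFactorization w).map rotations).flatten)).filterMap List.getLast?

/-- Fibonacci words over symbols `a < b`: `F 0 = b`, `F 1 = a`,
`F (i+2) = F (i+1) ++ F i`. -/
def fibWordG (a b : α) : ℕ → List α
  | 0 => [b]
  | 1 => [a]
  | n+2 => fibWordG a b (n+1) ++ fibWordG a b n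

/-- Fibonacci words over `Fin 2` with `a = 0 < b = 1`. -/
def fibWord : ℕ → List (Fin 2) := fibWordG 0 1

theorem rot_iterate_eq_rotate (x : List α) (i : ℕ) : rot^[i] x = x.rotate i := by
  have h : (rot : List α → List α) = fun x => x.rotate 1 := by
    funext x
    cases x <;> simp [rot]
  induction i generalizing x with
  | zero => simp
  | succ i ih => rw [Function.iterate_succ_apply, ih, h, List.rotate_rotate, add_comm]

theorem mem_rotations {x y : List α} (hx : x ≠ []) : y ∈ rotations x ↔ y ~r x := by
  have hlen : 0 < x.length := List.length_pos_iff.mpr hx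
  simp only [rotations, rot_iterate_eq_rotate, List.mem_map, List.mem_range]
  constructor
  · rintro ⟨i, -, rfl⟩
    exact List.IsRotated.forall x i
  · intro h
    obtain ⟨n, rfl⟩ := h.symm
    exact ⟨n % x.length, Nat.mod_lt _ hlen, List.rotate_mod x n⟩

theorem BWT_eq_of_pairwise_lt [LinearOrder α] {w : List α} (hw : w ≠ []) {T : List (List α)}
    (hT : T.Pairwise (· < ·)) (hrot : ∀ r ∈ T, r ~r w) (hlen : T.length = w.length) :
    BWT w = T.filterMap List.getLast? := by
  have hperm : T.Perm (rotations w) := by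
    refine (List.subperm_of_subset (hT.imp fun h => h.ne) fun r hr => ?_).perm_of_length_le ?_
    · exact (mem_rotations hw).2 (hrot r hr)
    · simp [rotations, hlen]
  rw [BWT, List.Perm.eq_of_pairwise' (r := (· ≤ ·)) (List.pairwise_insertionSort _ _)
    (hT.imp fun h => h.le) ((List.perm_insertionSort _ _).trans hperm.symm)]

theorem lexMinRotation_eq [LinearOrder α] {x m : List α} (hx : x ≠ []) (hm : m ~r x)
    (hmin : ∀ r, r ~r x → m ≤ r) : lexMinRotation x = m := by
  have hsort := List.pairwise_insertionSort (· ≤ ·) (rotations x)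
  have hmem : ∀ r, r ∈ List.insertionSort (· ≤ ·) (rotations x) ↔ r ~r x := fun r => by
    rw [List.mem_insertionSort, mem_rotations hx]
  unfold lexMinRotation
  generalize List.insertionSort (· ≤ ·) (rotations x) = l at hsort hmem
  cases l with
  | nil => simpa using (hmem m).2 hm
  | cons a l =>
    refine le_antisymm ?_ (hmin _ ((hmem a).1 (by simp)))
    rcases List.mem_cons.1 ((hmem m).2 hm) with h | h
    · exact h.ge
    · exact (List.pairwise_cons.1 hsort).1 m h

theorem IsRotated.exists_append {x y : List α} (h : y ~r x) : ∃ p q, x = p ++ q ∧ y = q ++ p := by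
  obtain ⟨n, rfl⟩ := h.symm
  exact ⟨_, _, (List.take_append_drop (n % x.length) x).symm,
    List.rotate_eq_drop_append_take_mod⟩

theorem IsRotated.flatMap {β : Type*} {x y : List α} (h : x ~r y) (f : α → List β) :
    x.flatMap f ~r y.flatMap f := by
  obtain ⟨p, q, rfl, rfl⟩ := IsRotated.exists_append h
  simpa using List.isRotated_append

theorem exists_of_flatMap_eq_append {β : Type*} {f : α → List β} {x : List α} {p q : List β}
    (h : x.flatMap f = p ++ q) (hq : q ≠ []) :
    ∃ x₁ l x₂ s t, x = x₁ ++ l :: x₂ ∧ f l = s ++ t ∧ t ≠ [] ∧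
      p = x₁.flatMap f ++ s ∧ q = t ++ x₂.flatMap f := by
  induction x generalizing p with
  | nil => simp_all
  | cons a x ih =>
    rw [List.flatMap_cons, List.append_eq_append_iff] at h
    rcases h with ⟨p', rfl, h⟩ | ⟨t, ha, rfl⟩
    · obtain ⟨x₁, l, x₂, s, t, rfl, h1, h2, rfl, h4⟩ := ih h
      exact ⟨a :: x₁, l, x₂, s, t, rfl, h1, h2, by rw [List.flatMap_cons, List.append_assoc], h4⟩
    · by_cases ht : t = []
      · subst ht
        obtain ⟨x₁, l, x₂, s, t, rfl, h1, h2, h3, h4⟩ := ih (p := []) (by simp)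
        refine ⟨a :: x₁, l, x₂, s, t, rfl, h1, h2, ?_, by simpa using h4⟩
        rw [List.flatMap_cons, List.append_assoc, ← h3, ha, List.append_nil, List.append_nil]
      · exact ⟨[], a, x, p, t, by simp, ha, ht, by simp, rfl⟩

theorem IsRotated.exists_of_flatMap {β : Type*} {f : α → List β} {x : List α} {y : List β}
    (h : y ~r x.flatMap f) (hy : y ≠ []) :
    ∃ l z s t, l :: z ~r x ∧ f l = s ++ t ∧ t ≠ [] ∧ y = t ++ z.flatMap f ++ s := by
  have key : ∀ p q, x.flatMap f = p ++ q → q ≠ [] →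
      ∃ l z s t, l :: z ~r x ∧ f l = s ++ t ∧ t ≠ [] ∧ q ++ p = t ++ z.flatMap f ++ s := by
    intro p q hpq hq
    obtain ⟨x₁, l, x₂, s, t, rfl, h1, h2, rfl, rfl⟩ := exists_of_flatMap_eq_append hpq hq
    exact ⟨l, x₂ ++ x₁, s, t, by simpa using List.isRotated_append (l := l :: x₂) (l' := x₁),
      h1, h2, by simp⟩
  obtain ⟨p, q, hx, rfl⟩ := IsRotated.exists_append h
  by_cases hq : q = []
  · subst hq
    simpa using key [] p (by simpa using hx) (by simpa using hy)
  · exact key p q hx hq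

theorem flatMap_append_lt {β : Type*} [LinearOrder α] [LinearOrder β] {f : α → List β}
    (hf : ∀ i j, i < j → ∀ s t, f i ++ s < f j ++ t) {x y : List α}
    (hlen : x.length = y.length) (h : x < y) (s t : List β) :
    x.flatMap f ++ s < y.flatMap f ++ t := by
  induction x generalizing y with
  | nil => simp_all [eq_comm]
  | cons a x ih =>
    cases y with
    | nil => simp at hlen
    | cons b y =>
      rw [List.flatMap_cons, List.flatMap_cons, List.append_assoc, List.append_assoc]
      rcases List.cons_lt_cons_iff.1 h with hab | ⟨rfl, hxy⟩
      · exact hf a b hab _ _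
      · exact List.append_left_lt (ih (by simpa using hlen) hxy)

theorem lt_of_append_singleton_lt [LinearOrder α] {x y : List α} {a b : α}
    (hperm : (x ++ [a]).Perm (y ++ [b])) (h : x ++ [a] < y ++ [b]) : x < y := by
  have hlen : x.length = y.length := by simpa using hperm.length_eq
  by_contra! hyx
  rcases hyx.eq_or_lt with rfl | hyx
  · have := (List.perm_append_left_iff y).1 hperm
    simp_all
  · have := flatMap_append_lt (f := fun i => [i])
      (fun i j hij s t => by simp [List.cons_lt_cons_iff, hij]) hlen.symm hyx [b] [a]
    simp at this
    exact lt_asymm h this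

/-- The morphism `0 ↦ 001`, `1 ↦ 01`, `2 ↦ d`. -/
def fibSubst {n : ℕ} (d : Fin (n + 2)) : Fin 3 → List (Fin (n + 2)) :=
  ![[0, 0, 1], [0, 1], [d]]

/-- The Lyndon conjugate of the Fibonacci word of even index `2 * k`. -/
def fibLyndon : ℕ → List (Fin 2)
  | 0 => [1]
  | k + 1 => (fibLyndon k).flatMap fun i => fibSubst 1 i.castSucc

/-- The word `fibLyndon k` over the alphabet extended by a larger letter `2`. -/
def fibLyndonExt (k : ℕ) : List (Fin 3) := (fibLyndon k).map Fin.castSucc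

section fibSubst

variable {n : ℕ} {d : Fin (n + 2)}

@[simp] theorem fibSubst_zero : fibSubst d 0 = [0, 0, 1] := rfl
@[simp] theorem fibSubst_one : fibSubst d 1 = [0, 1] := rfl
@[simp] theorem fibSubst_two : fibSubst d 2 = [d] := rfl

theorem fibSubst_append_lt (hd : 0 < d) (i j : Fin 3) (hij : i < j) (s t : List (Fin (n + 2))) :
    fibSubst d i ++ s < fibSubst d j ++ t := by
  fin_cases i <;> fin_cases j <;> simp_all [List.cons_lt_cons_iff]

end fibSubst

theorem fibLyndonExt_succ (k : ℕ) :
    fibLyndonExt (k + 1) = (fibLyndonExt k).flatMap (fibSubst 2) := by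
  simp only [fibLyndonExt, fibLyndon, List.map_flatMap, List.flatMap_map]
  congr 1
  funext i
  fin_cases i <;> rfl

theorem flatMap_fibLyndonExt (k : ℕ) :
    (fibLyndonExt k).flatMap (fibSubst 1) = fibLyndon (k + 1) := by
  simp only [fibLyndonExt, fibLyndon, List.flatMap_map]

theorem head?_fibLyndon_succ (k : ℕ) : (fibLyndon (k + 1)).head? = some 0 := by
  induction k with
  | zero => rfl
  | succ k ih =>
    obtain ⟨t, ht⟩ := List.head?_eq_some_iff.1 ih
    rw [fibLyndon, ht]
    rfl

theorem fibLyndon_ne_nil (k : ℕ) : fibLyndon k ≠ [] := by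
  cases k with
  | zero => simp [fibLyndon]
  | succ k =>
    intro h
    simpa [h] using head?_fibLyndon_succ k

theorem fibSubst_eq_cons_append {l a : Fin 2} {s t : List (Fin 2)}
    (h : fibSubst 1 l.castSucc = a :: s ++ t) (ht : t ≠ []) : l = 0 ∧ t = [0, 1] ∨ t = [1] := by
  fin_cases l
  · change [0, 0, 1] = _ at h
    rcases s with _ | ⟨b, _ | ⟨c, s⟩⟩
    · exact .inl ⟨rfl, (List.cons.inj h).2.symm⟩
    all_goals simp_all
  · change [0, 1] = _ at h
    rcases s with _ | ⟨b, s⟩ <;> simp_all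

theorem fibLyndon_le_of_isRotated (k : ℕ) {r : List (Fin 2)} (hr : r ~r fibLyndon k) :
    fibLyndon k ≤ r := by
  induction k generalizing r with
  | zero => simp_all [fibLyndon]
  | succ k ih =>
    have hne : r ≠ [] := fun h => fibLyndon_ne_nil (k + 1) (by simpa [h, eq_comm] using hr)
    rw [fibLyndon] at hr
    obtain ⟨l, z, s, t, hlz, hst, ht, rfl⟩ := IsRotated.exists_of_flatMap hr hne
    cases s with
    | nil =>
      obtain rfl : _ = t := hst
      rw [fibLyndon, List.append_nil,
        ← List.flatMap_cons (f := fun i : Fin 2 => fibSubst 1 i.castSucc)]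
      rcases (ih hlz).eq_or_lt with h | h
      · rw [h]
      · have := flatMap_append_lt (f := fun i : Fin 2 => fibSubst (1 : Fin 2) i.castSucc)
          (fun i j hij s t => fibSubst_append_lt (by decide) _ _ (by simpa using hij) s t)
          hlz.perm.length_eq.symm h [] []
        simpa using this.le
    | cons a s =>
      have ht' := fibSubst_eq_cons_append hst ht
      cases k with
      | zero =>
        obtain ⟨rfl, rfl⟩ : l = 1 ∧ z = [] := by simpa [fibLyndon] using hlz
        obtain rfl : t = [1] := by simpa using ht'
        exact le_of_lt (List.cons_lt_cons_iff.2 (.inl (by decide)))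
      | succ k =>
        obtain ⟨u, hu⟩ := List.head?_eq_some_iff.1 (head?_fibLyndon_succ k)
        rw [fibLyndon, hu]
        refine le_of_lt ?_
        change 0 :: 0 :: 1 :: _ < _
        rcases ht' with ⟨-, rfl⟩ | rfl <;> simp [List.cons_lt_cons_iff]

/-- The morphism `0 ↦ 010`, `1 ↦ 01`, the square of the Fibonacci morphism. -/
def fibMorphismSq : Fin 2 → List (Fin 2) := ![[0, 1, 0], [0, 1]]

theorem flatMap_fibMorphismSq_fibWord (n : ℕ) :
    (fibWord n).flatMap fibMorphismSq = fibWord (n + 2) := by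
  induction n using Nat.twoStepInduction with
  | zero => rfl
  | one => rfl
  | more n ih1 ih2 =>
    have h (m : ℕ) : fibWord (m + 2) = fibWord (m + 1) ++ fibWord m := rfl
    rw [h n, List.flatMap_append, ih1, ih2, h (n + 2)]

theorem append_flatMap_fibSubst (x : List (Fin 2)) :
    [0, 1] ++ x.flatMap (fun i => fibSubst 1 i.castSucc) =
      x.flatMap fibMorphismSq ++ [0, 1] := by
  induction x with
  | nil => rfl
  | cons i x ih =>
    have h : [0, 1] ++ fibSubst 1 i.castSucc = fibMorphismSq i ++ [0, 1] := by
      fin_cases i <;> rfl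
    rw [List.flatMap_cons, List.flatMap_cons, ← List.append_assoc, h, List.append_assoc, ih,
      List.append_assoc]

theorem isRotated_of_append_eq_append {u x y : List α} (hlen : u.length ≤ y.length)
    (h : u ++ x = y ++ u) : x ~r y := by
  obtain ⟨v, rfl⟩ : u <+: y := List.prefix_of_prefix_length_le ⟨x, h⟩ ⟨u, rfl⟩ hlen
  rw [List.append_assoc, List.append_cancel_left_eq] at h
  rw [h]
  exact List.isRotated_append

theorem fibLyndon_isRotated_fibWord (k : ℕ) : fibLyndon k ~r fibWord (2 * k) := by
  induction k with
  | zero => rfl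
  | succ k ih =>
    rw [Nat.mul_succ, ← flatMap_fibMorphismSq_fibWord, fibLyndon]
    refine (isRotated_of_append_eq_append ?_ (append_flatMap_fibSubst _)).trans
      (IsRotated.flatMap ih _)
    obtain ⟨i, x, hx⟩ := List.exists_cons_of_ne_nil (fibLyndon_ne_nil k)
    rw [hx]
    fin_cases i <;> simp [fibMorphismSq]

theorem lexMinRotation_fibWord (k : ℕ) : lexMinRotation (fibWord (2 * k)) = fibLyndon k := by
  have h := fibLyndon_isRotated_fibWord k
  refine lexMinRotation_eq (fun h0 => fibLyndon_ne_nil k ?_) h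
    fun r hr => fibLyndon_le_of_isRotated k (hr.trans h.symm)
  simpa [h0] using h

section substitutionRows

variable {n : ℕ}

/-- For a word ending in `0` or `1`, the rotation of its image under `fibSubst d` that moves the
final `1` to the front. -/
def shiftOne (d : Fin (n + 2)) (r : List (Fin 3)) : List (Fin (n + 2)) :=
  1 :: (r.flatMap (fibSubst d)).dropLast

/-- For a word ending in `0` or `1`, the rotation of its image under `fibSubst d` that moves the
final `01` to the front. -/
def shiftTwo (d : Fin (n + 2)) (r : List (Fin 3)) : List (Fin (n + 2)) :=
  0 :: 1 :: (r.flatMap (fibSubst d)).dropLast.dropLast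

/-- The images under `fibSubst d` of the words of `R` starting with `0`. -/
def substRows (d : Fin (n + 2)) (R : List (List (Fin 3))) : List (List (Fin (n + 2))) :=
  (R.filter fun r => r.head? = some 0).map fun r => r.flatMap (fibSubst d)

variable {d : Fin (n + 2)} {r s : List (Fin 3)} {x : Fin 3}

theorem fibSubst_eq_append (hx : x ≠ 2) :
    ∃ t : List (Fin (n + 2)), ∀ d, fibSubst d x = t ++ [0, 1] := by
  fin_cases x
  · exact ⟨[0], fun _ => rfl⟩
  · exact ⟨[], fun _ => rfl⟩
  · exact absurd rfl hx

theorem exists_shiftOne_eq (d : Fin (n + 2)) (s : List (Fin 3)) (x : Fin 3) :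
    ∃ t, shiftOne d (s ++ [x]) = 1 :: (s.flatMap (fibSubst d) ++ t) := by
  refine ⟨(fibSubst d x).dropLast, ?_⟩
  rw [shiftOne, List.flatMap_append, List.flatMap_singleton, List.dropLast_append_of_ne_nil]
  fin_cases x <;> simp

theorem exists_shiftTwo_eq (d : Fin (n + 2)) (s : List (Fin 3)) (hx : x ≠ 2) :
    ∃ t, shiftTwo d (s ++ [x]) = 0 :: 1 :: (s.flatMap (fibSubst d) ++ t) := by
  obtain ⟨t, ht⟩ := fibSubst_eq_append (n := n) hx
  exact ⟨t, by simp [shiftTwo, ht]⟩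

theorem shiftOne_isRotated (hx : x ≠ 2) :
    shiftOne d (s ++ [x]) ~r (s ++ [x]).flatMap (fibSubst d) := by
  obtain ⟨t, ht⟩ := fibSubst_eq_append (n := n) hx
  have h := List.IsRotated.cons_append_singleton (a := (1 : Fin (n + 2)))
    (l := s.flatMap (fibSubst d) ++ (t ++ [0]))
  rw [List.append_assoc, List.append_assoc] at h
  simpa [shiftOne, ht, List.dropLast_append] using h

theorem shiftTwo_isRotated (hx : x ≠ 2) :
    shiftTwo d (s ++ [x]) ~r (s ++ [x]).flatMap (fibSubst d) := by
  obtain ⟨t, ht⟩ := fibSubst_eq_append (n := n) hx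
  simpa [shiftTwo, ht, List.dropLast_append] using
    List.isRotated_append (l := [0, 1]) (l' := s.flatMap (fibSubst d) ++ t)

theorem getLast?_flatMap_fibSubst (hx : x ≠ 2) :
    ((s ++ [x]).flatMap (fibSubst d)).getLast? = some 1 := by
  obtain ⟨t, ht⟩ := fibSubst_eq_append (n := n) hx
  simp [ht, List.getLast?_append]

theorem getLast?_shiftOne (hx : x ≠ 2) : (shiftOne d (s ++ [x])).getLast? = some 0 := by
  obtain ⟨t, ht⟩ := fibSubst_eq_append (n := n) hx
  simp [shiftOne, ht, List.getLast?_cons, List.getLast?_append]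

theorem getLast?_shiftTwo_zero : (shiftTwo d (s ++ [0])).getLast? = some 0 := by
  simp [shiftTwo, List.getLast?_cons, List.getLast?_append]

theorem getLast?_shiftTwo_one (hx : x ≠ 2) :
    (shiftTwo d (s ++ [x] ++ [1])).getLast? = some 1 := by
  obtain ⟨t, ht⟩ := fibSubst_eq_append (n := n) hx
  simp [shiftTwo, ht, List.getLast?_cons, List.getLast?_append]

end substitutionRows

theorem eq_of_cons_isRotated_cons {c : α} {x y : List α} (hy : c ∉ y)
    (h : c :: x ~r c :: y) : x = y := by
  obtain ⟨p, q, hpq, hqp⟩ := IsRotated.exists_append h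
  cases p with
  | nil => exact List.tail_eq_of_cons_eq (hqp.trans ((List.append_nil q).trans hpq.symm))
  | cons a p =>
    cases q with
    | nil => simp_all
    | cons b q => simp_all

theorem append_eq_of_isRotated_cons {c : α} {x y z : List α} (hz : c ∉ z)
    (h : x ++ c :: y ~r c :: z) : y ++ x = z :=
  eq_of_cons_isRotated_cons hz <|
    (List.isRotated_append (l := c :: y) (l' := x)).trans h

/-- `R` lists in increasing order the rotations of `2 :: G`, except for the smallest one,
which is `G ++ [2]`. -/
structure IsRotationTable (G : List (Fin 3)) (R : List (List (Fin 3))) : Prop where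
  two_notMem : 2 ∉ G
  head?_eq : G.head? = some 0
  isRotated : ∀ r ∈ R, r ~r 2 :: G
  pairwise_lt : ((G ++ [2]) :: R).Pairwise (· < ·)
  length_eq : R.length = G.length
  countP_head : (R.countP fun r => r.head? = some 0) + 1 = G.count 0

/-- The rotation table of the image of `G` under `fibSubst 2`. -/
def nextTable (G : List (Fin 3)) (R : List (List (Fin 3))) : List (List (Fin 3)) :=
  substRows 2 R ++ (R.map (shiftTwo 2) ++ (R.map (shiftOne 2) ++ [2 :: G.flatMap (fibSubst 2)]))

namespace IsRotationTable

variable {n : ℕ} {d : Fin (n + 2)} {G : List (Fin 3)} {R : List (List (Fin 3))}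

theorem exists_eq_append (h : IsRotationTable G R) {r : List (Fin 3)} (hr : r ∈ R) :
    ∃ s x, x ≠ 2 ∧ r = s ++ [x] := by
  have hrot := h.isRotated r hr
  rcases List.eq_nil_or_concat r with rfl | ⟨s, x, rfl⟩
  · simp at hrot
  rw [List.concat_eq_append] at *
  refine ⟨s, x, ?_, rfl⟩
  rintro rfl
  have hs : s = G := by simpa using append_eq_of_isRotated_cons h.two_notMem hrot
  have := (List.pairwise_cons.1 h.pairwise_lt).1 _ hr
  simp [hs] at this

theorem exists_eq_append_one (h : IsRotationTable G R) {s : List (Fin 3)} (hr : s ++ [1] ∈ R) :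
    ∃ t x, x ≠ 2 ∧ s = t ++ [x] := by
  have hrot := h.isRotated _ hr
  rcases List.eq_nil_or_concat s with rfl | ⟨t, x, rfl⟩
  · simp at hrot
  rw [List.concat_eq_append] at *
  refine ⟨t, x, ?_, rfl⟩
  rintro rfl
  have ht : [1] ++ t = G := append_eq_of_isRotated_cons h.two_notMem (by simpa using hrot)
  have := h.head?_eq
  simp [← ht] at this

theorem isRotated_of_mem_cons (h : IsRotationTable G R) {r : List (Fin 3)}
    (hr : r ∈ (G ++ [2]) :: R) : r ~r 2 :: G := by
  rcases List.mem_cons.1 hr with rfl | hr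
  · exact List.isRotated_append
  · exact h.isRotated r hr

theorem pairwise_lt_rows (h : IsRotationTable G R) (hd : 0 < d) :
    (substRows d ((G ++ [2]) :: R) ++
      (R.map (shiftTwo d) ++ ((G ++ [2]) :: R).map (shiftOne d))).Pairwise (· < ·) := by
  have hlt := fibSubst_append_lt hd
  have hperm {r s} (hr : r ∈ (G ++ [2]) :: R) (hs : s ∈ (G ++ [2]) :: R) : r.Perm s :=
    ((h.isRotated_of_mem_cons hr).trans (h.isRotated_of_mem_cons hs).symm).perm
  have hcut {r s} {x y : Fin 3} (hr : r ++ [x] ∈ (G ++ [2]) :: R)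
      (hs : s ++ [y] ∈ (G ++ [2]) :: R) (hrs : r ++ [x] < s ++ [y]) (t u : List (Fin (n + 2))) :
      r.flatMap (fibSubst d) ++ t < s.flatMap (fibSubst d) ++ u :=
    flatMap_append_lt hlt (by simpa using (hperm hr hs).length_eq)
      (lt_of_append_singleton_lt (hperm hr hs) hrs) t u
  refine List.pairwise_append.2 ⟨?_, List.pairwise_append.2 ⟨?_, ?_, ?_⟩, ?_⟩
  · refine List.pairwise_map.2 ((h.pairwise_lt.filter _).imp_of_mem fun hr hs hrs => ?_)
    simpa using flatMap_append_lt hlt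
      (hperm (List.mem_of_mem_filter hr) (List.mem_of_mem_filter hs)).length_eq hrs [] []
  · refine List.pairwise_map.2 ((List.pairwise_cons.1 h.pairwise_lt).2.imp_of_mem
      fun hr hs hrs => ?_)
    obtain ⟨r, x, hx, rfl⟩ := h.exists_eq_append hr
    obtain ⟨s, y, hy, rfl⟩ := h.exists_eq_append hs
    obtain ⟨t, ht⟩ := exists_shiftTwo_eq d r hx
    obtain ⟨u, hu⟩ := exists_shiftTwo_eq d s hy
    rw [ht, hu, List.cons_lt_cons_iff, List.cons_lt_cons_iff]
    exact .inr ⟨rfl, .inr ⟨rfl,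
      hcut (List.mem_cons_of_mem _ hr) (List.mem_cons_of_mem _ hs) hrs t u⟩⟩
  · have happ {r} (hr : r ∈ (G ++ [2]) :: R) : ∃ s x, r = s ++ [x] := by
      rcases List.mem_cons.1 hr with rfl | hr
      · exact ⟨_, _, rfl⟩
      · obtain ⟨s, x, -, rfl⟩ := h.exists_eq_append hr
        exact ⟨s, x, rfl⟩
    refine List.pairwise_map.2 (h.pairwise_lt.imp_of_mem fun hr hs hrs => ?_)
    obtain ⟨r, x, rfl⟩ := happ hr
    obtain ⟨s, y, rfl⟩ := happ hs
    obtain ⟨t, ht⟩ := exists_shiftOne_eq d r x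
    obtain ⟨u, hu⟩ := exists_shiftOne_eq d s y
    rw [ht, hu, List.cons_lt_cons_iff]
    exact .inr ⟨rfl, hcut hr hs hrs t u⟩
  · simp only [List.mem_map]
    rintro _ ⟨r, -, rfl⟩ _ ⟨s, -, rfl⟩
    simp [shiftOne, shiftTwo, List.cons_lt_cons_iff]
  · simp only [substRows, List.mem_append, List.mem_map, List.mem_filter, decide_eq_true_eq]
    rintro _ ⟨r, ⟨-, hr⟩, rfl⟩ _ (⟨s, -, rfl⟩ | ⟨s, -, rfl⟩) <;>
    obtain ⟨t, rfl⟩ := List.head?_eq_some_iff.1 hr <;>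
    simp [shiftOne, shiftTwo, List.cons_lt_cons_iff]

theorem isRotated_of_mem_substRows (h : IsRotationTable G R) {r : List (Fin (n + 2))}
    (hr : r ∈ substRows d ((G ++ [2]) :: R)) : r ~r (2 :: G).flatMap (fibSubst d) := by
  obtain ⟨s, hs, rfl⟩ := List.mem_map.1 hr
  exact IsRotated.flatMap (h.isRotated_of_mem_cons (List.mem_of_mem_filter hs)) _

theorem shiftTwo_isRotated (h : IsRotationTable G R) {r : List (Fin 3)} (hr : r ∈ R) :
    shiftTwo d r ~r (2 :: G).flatMap (fibSubst d) := by
  have hrot := IsRotated.flatMap (h.isRotated r hr) (fibSubst d)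
  obtain ⟨s, x, hx, rfl⟩ := h.exists_eq_append hr
  exact (_root_.shiftTwo_isRotated hx).trans hrot

theorem shiftOne_isRotated (h : IsRotationTable G R) {r : List (Fin 3)} (hr : r ∈ R) :
    shiftOne d r ~r (2 :: G).flatMap (fibSubst d) := by
  have hrot := IsRotated.flatMap (h.isRotated r hr) (fibSubst d)
  obtain ⟨s, x, hx, rfl⟩ := h.exists_eq_append hr
  exact (_root_.shiftOne_isRotated hx).trans hrot

theorem length_flatMap (hG : 2 ∉ G) :
    (G.flatMap (fibSubst d)).length = G.count 0 + 2 * G.length := by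
  induction G with
  | nil => rfl
  | cons x G ih =>
    have := ih (fun h => hG (List.mem_cons_of_mem _ h))
    fin_cases x <;> simp_all <;> ring

theorem count_zero_flatMap (hG : 2 ∉ G) :
    (G.flatMap (fibSubst d)).count 0 = G.count 0 + G.length := by
  induction G with
  | nil => rfl
  | cons x G ih =>
    have := ih (fun h => hG (List.mem_cons_of_mem _ h))
    fin_cases x <;> simp_all [List.flatMap_cons] <;> ring

theorem length_substRows (R : List (List (Fin 3))) :
    (substRows d R).length = R.countP fun r => r.head? = some 0 := by
  simp [substRows, List.countP_eq_length_filter]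

theorem substRows_cons (h : IsRotationTable G R) :
    substRows d ((G ++ [2]) :: R) = (G.flatMap (fibSubst d) ++ [d]) :: substRows d R := by
  simp [substRows, h.head?_eq]

theorem next (h : IsRotationTable G R) :
    IsRotationTable (G.flatMap (fibSubst 2)) (nextTable G R) where
  two_notMem := by
    intro h2
    obtain ⟨x, hx, h2⟩ := List.mem_flatMap.1 h2
    obtain rfl : x = 2 := by fin_cases x <;> simp_all
    exact h.two_notMem hx
  head?_eq := by
    obtain ⟨t, rfl⟩ := List.head?_eq_some_iff.1 h.head?_eq
    rfl
  isRotated r hr := by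
    simp only [nextTable, List.mem_append, List.mem_map, List.mem_singleton] at hr
    rcases hr with hr | ⟨r, hr, rfl⟩ | ⟨r, hr, rfl⟩ | rfl
    · exact h.isRotated_of_mem_substRows (by simp [h.substRows_cons, hr])
    · exact h.shiftTwo_isRotated hr
    · exact h.shiftOne_isRotated hr
    · rfl
  pairwise_lt := by
    have hp := h.pairwise_lt_rows (d := (2 : Fin (1 + 2))) (by decide)
    rw [h.substRows_cons, List.map_cons] at hp
    rw [nextTable, ← List.cons_append, ← List.append_assoc, ← List.append_assoc]
    refine List.pairwise_append.2 ⟨hp.sublist ?_, List.pairwise_singleton _ _, ?_⟩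
    · rw [List.append_assoc]
      exact (((List.sublist_cons_self _ _).append_left _).append_left _)
    · rw [← h.substRows_cons]
      simp only [substRows, List.mem_append, List.mem_map, List.mem_filter,
        decide_eq_true_eq, List.mem_singleton]
      rintro _ ((⟨r, ⟨-, hr⟩, rfl⟩ | ⟨r, -, rfl⟩) | ⟨r, -, rfl⟩) _ rfl
      · obtain ⟨t, rfl⟩ := List.head?_eq_some_iff.1 hr
        simp [List.cons_lt_cons_iff]
      · simp [shiftTwo, List.cons_lt_cons_iff]
      · simp [shiftOne, List.cons_lt_cons_iff]
  length_eq := by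
    have := h.countP_head
    simp only [nextTable, List.length_append, List.length_map, length_substRows,
      List.length_singleton, h.length_eq, length_flatMap h.two_notMem]
    omega
  countP_head := by
    have h0 : ((substRows (2 : Fin (1 + 2)) R).countP fun r => r.head? = some 0) =
        R.countP fun r => r.head? = some 0 := by
      rw [← length_substRows (d := (2 : Fin (1 + 2))) R, List.countP_eq_length]
      intro r hr
      obtain ⟨s, hs, rfl⟩ := List.mem_map.1 hr
      obtain ⟨t, rfl⟩ := List.head?_eq_some_iff.1 (by simpa using (List.mem_filter.1 hs).2)
      simp
    rw [count_zero_flatMap h.two_notMem, ← h.countP_head, ← h.length_eq]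
    simp [nextTable, h0, List.countP_map, Function.comp_def, shiftOne, shiftTwo]
    ring

theorem getLast?_cons_flatMap (h : IsRotationTable G R) (c : Fin (n + 2)) :
    (c :: G.flatMap (fibSubst d)).getLast? = some 1 := by
  have hG := h.two_notMem
  have h0 := h.head?_eq
  rcases List.eq_nil_or_concat G with rfl | ⟨s, x, rfl⟩
  · simp at h0
  rw [List.concat_eq_append] at *
  rw [List.getLast?_cons, getLast?_flatMap_fibSubst fun hx => hG (by simp [hx])]
  rfl

theorem map_getLast?_substRows (h : IsRotationTable G R) :
    (substRows d R).map List.getLast? =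
      List.replicate (R.countP fun r => r.head? = some 0) (some 1) := by
  rw [← length_substRows (d := d), List.map_eq_replicate_iff]
  intro r hr
  obtain ⟨s, hs, rfl⟩ := List.mem_map.1 hr
  obtain ⟨s, x, hx, rfl⟩ := h.exists_eq_append (List.mem_of_mem_filter hs)
  exact getLast?_flatMap_fibSubst hx

theorem map_getLast?_shiftOne (h : IsRotationTable G R) :
    (R.map (shiftOne d)).map List.getLast? = List.replicate G.length (some 0) := by
  rw [← h.length_eq, List.map_map, List.map_eq_replicate_iff]
  intro r hr
  obtain ⟨s, x, hx, rfl⟩ := h.exists_eq_append hr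
  exact getLast?_shiftOne hx

theorem map_getLast?_shiftTwo (h : IsRotationTable G R) {B : List (Fin 2)}
    (hB : R.map List.getLast? = B.map fun i => some (i.castLE (by omega))) :
    (R.map (shiftTwo d)).map List.getLast? = B.map fun i => some (i.castLE (by omega)) := by
  have key : ∀ r ∈ R, ∀ i : Fin 2, r.getLast? = some (i.castLE (by omega)) →
      (shiftTwo d r).getLast? = some (i.castLE (by omega)) := by
    intro r hr i hi
    obtain ⟨s, x, hx, rfl⟩ := h.exists_eq_append hr
    obtain rfl : x = i.castLE (by omega) := by simpa using hi
    fin_cases i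
    · exact getLast?_shiftTwo_zero
    · obtain ⟨t, y, hy, rfl⟩ := h.exists_eq_append_one hr
      exact getLast?_shiftTwo_one hy
  clear h
  induction R generalizing B with
  | nil => simpa using hB
  | cons r R ih =>
    cases B with
    | nil => simp at hB
    | cons i B =>
      simp only [List.map_cons, List.cons.injEq] at hB ⊢
      exact ⟨key r (by simp) i hB.1, ih hB.2 fun s hs => key s (List.mem_cons_of_mem _ hs)⟩

end IsRotationTable

theorem runsCount_replicate_append [DecidableEq α] (a : α) (m : ℕ) (t : List α) :
    runsCount (a :: (List.replicate m a ++ t)) = runsCount (a :: t) := by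
  induction m with
  | zero => rfl
  | succ m ih => simpa [List.replicate_succ, runsCount] using ih

theorem exists_isRotationTable (k : ℕ) :
    ∃ R, ∃ B : List (Fin 2), IsRotationTable (fibLyndonExt (k + 1)) R ∧
      (R.map List.getLast? = B.map fun i => some (i.castLE (by omega))) ∧
      ∀ t, runsCount (1 :: (B ++ t)) = 2 * (k + 1) + runsCount (1 :: t) := by
  induction k with
  | zero =>
    refine ⟨[[1, 2, 0], [2, 0, 1]], [0, 1], ⟨by decide, rfl, ?_, ?_, rfl, rfl⟩, rfl, fun t => ?_⟩
    · simp only [List.mem_cons, List.not_mem_nil, or_false]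
      rintro _ (rfl | rfl)
      · exact ⟨1, rfl⟩
      · exact ⟨0, rfl⟩
    · decide
    · simp [runsCount]
      ring
  | succ k ih =>
    obtain ⟨R, B, h, hB, hruns⟩ := ih
    obtain ⟨m, hm⟩ : ∃ m, (fibLyndonExt (k + 1)).length = m + 1 :=
      Nat.exists_eq_succ_of_ne_zero (by simp [fibLyndonExt, fibLyndon_ne_nil])
    refine ⟨nextTable (fibLyndonExt (k + 1)) R,
      List.replicate (R.countP fun r => r.head? = some 0) 1 ++
        (B ++ (List.replicate (fibLyndonExt (k + 1)).length 0 ++ [1])),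
      ?_, ?_, fun t => ?_⟩
    · rw [fibLyndonExt_succ]
      exact h.next
    · have hlast : ((2 : Fin (1 + 2)) :: (fibLyndonExt (k + 1)).flatMap (fibSubst 2)).getLast? =
          some 1 := by
        exact h.getLast?_cons_flatMap _
      rw [nextTable, List.map_append, List.map_append, List.map_append, h.map_getLast?_substRows,
        h.map_getLast?_shiftOne, h.map_getLast?_shiftTwo hB]
      simp [hlast]
    · rw [List.append_assoc, runsCount_replicate_append, List.append_assoc, hruns, hm,
        List.replicate_succ]
      simp only [List.cons_append, List.append_assoc, runsCount]
      rw [runsCount_replicate_append]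
      simp [runsCount]
      ring

theorem runsCount_BWT_cons_fibLyndon (k : ℕ) :
    runsCount (BWT (1 :: fibLyndon (k + 2))) = 2 * (k + 2) := by
  obtain ⟨R, B, h, hB, hruns⟩ := exists_isRotationTable k
  set G := fibLyndonExt (k + 1) with hG
  have hw : (1 : Fin 2) :: fibLyndon (k + 2) = (2 :: G).flatMap (fibSubst 1) := by
    rw [← flatMap_fibLyndonExt]
    rfl
  have hone : shiftOne (1 : Fin (0 + 2)) (G ++ [2]) = (2 :: G).flatMap (fibSubst 1) := by
    simp [shiftOne]
  have hlast : ((2 :: G).flatMap (fibSubst (1 : Fin 2))).getLast? = some 1 :=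
    h.getLast?_cons_flatMap _
  obtain ⟨m, hm⟩ : ∃ m, G.length = m + 1 :=
    Nat.exists_eq_succ_of_ne_zero (by simp [hG, fibLyndonExt, fibLyndon_ne_nil])
  have hBWT : BWT (1 :: fibLyndon (k + 2)) =
      1 :: (List.replicate (R.countP fun r => r.head? = some 0) 1 ++
        (B ++ 1 :: List.replicate G.length 0)) := by
    rw [hw, BWT_eq_of_pairwise_lt (by simp)
      (h.pairwise_lt_rows (by decide : (0 : Fin (0 + 2)) < 1))]
    · refine (List.filterMap_map (f := List.getLast?) (g := id)).symm.trans ?_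
      rw [List.map_append, List.map_append, h.map_getLast?_shiftTwo hB, h.substRows_cons,
        List.map_cons, List.map_cons, List.map_cons, h.map_getLast?_substRows,
        h.map_getLast?_shiftOne, hone, hlast]
      simp [List.filterMap_map]
    · intro r hr
      simp only [List.map_cons, List.mem_append, List.mem_map, List.mem_cons] at hr
      rcases hr with hr | ⟨r, hr, rfl⟩ | rfl | ⟨r, hr, rfl⟩
      · exact h.isRotated_of_mem_substRows hr
      · exact h.shiftTwo_isRotated hr
      · rw [hone]
      · exact h.shiftOne_isRotated hr
    · have := h.countP_head
      simp [IsRotationTable.length_substRows, h.length_eq, h.head?_eq,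
        IsRotationTable.length_flatMap h.two_notMem]
      omega
  rw [hBWT, runsCount_replicate_append, hruns, hm, List.replicate_succ]
  have := runsCount_replicate_append (0 : Fin 2) m []
  simp_all [runsCount]
  ring

/-- for every `k ≥ 2`, the string `w_k = b · F*_{2k}` satisfies
`r(w_k) = 2k`. -/
theorem stmt2 (k : ℕ) (hk : 2 ≤ k) :
    runsCount (BWT (1 :: lexMinRotation (fibWord (2 * k)))) = 2 * k := by
  obtain ⟨k, rfl⟩ := Nat.exists_eq_add_of_le' hk
  rw [lexMinRotation_fibWord]
  exact runsCount_BWT_cons_fibLyndon k
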